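/- arXiv:2410.00646 — 4 statements merged into one kernel-verified Lean document; each statement's English description precedes it below -/
import Mathlib

section
/- Let p be an odd prime and m ≥ 1 an integer. Then S(m+1,φ)_p = p·φ(−1)·Σ_{x₁,…,x_m ∈ F_p^×} φ(x₁ + x₂ + ⋯ + x_m + 1)·φ(x₁⁻¹ + x₂⁻¹ + ⋯ + x_m⁻¹ + 1). -/
open Finset

/-- The standard additive character of `ZMod p`: `θ(x) = e^{2πi x/p}`. -/
noncomputable def theta (p : ℕ) (x : ZMod p) : ℂ :=
  Complex.exp (2 * Real.pi * Complex.I * (x.val : ℂ) / p)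

/-- The classical Kloosterman sum `K(a,p) = Σ_{x ∈ F_p^×} θ(x + a x⁻¹)`. -/
noncomputable def Kl (p : ℕ) [NeZero p] (a : ZMod p) : ℂ :=
  ∑ x ∈ Finset.univ.filter (fun x : ZMod p => x ≠ 0), theta p (x + a * x⁻¹)

open scoped Classical in
/-- The quadratic character of `F_p`, with `φ(0) = 0`. -/
noncomputable def phi (p : ℕ) (a : ZMod p) : ℤ :=
  if a = 0 then 0 else if IsSquare a then 1 else -1

/-- The `n`-th twisted moment of Kloosterman sums `S(n,φ)_p = Σ_{a ∈ F_p} φ(a) K(a,p)^n`. -/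
noncomputable def S (p : ℕ) [NeZero p] (n : ℕ) : ℂ :=
  ∑ a : ZMod p, (phi p a : ℂ) * Kl p a ^ n

section Moment

variable {F R : Type*} [Field F] [Fintype F] [CommRing R]

/-- A nontrivial multiplicative character is, up to the Gauss sum, the conjugate of its own Fourier
transform, also at `0`. -/
theorem sum_mulChar_mul_addChar [IsDomain R] {χ : MulChar F R} (hχ : χ ≠ 1) (ψ : AddChar F R) (b : F) :
    ∑ a, χ a * ψ (a * b) = χ⁻¹ b * gaussSum χ ψ := by
  rcases eq_or_ne b 0 with rfl | hb
  · simp [MulChar.map_zero, MulChar.sum_eq_zero_of_ne_one hχ]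
  · have h := gaussSum_mulShift_eq χ ψ (Units.mk0 b hb)
    simpa [gaussSum, AddChar.mulShift_apply, mul_comm b] using h

variable [DecidableEq F]

/-- Powers of a Kloosterman sum, with all but one of the variables rescaled by the remaining
one. -/
theorem kloosterman_pow_succ (ψ : AddChar F R) (a : F) (m : ℕ) :
    (∑ x ∈ univ.filter (fun x : F => x ≠ 0), ψ (x + a * x⁻¹)) ^ (m + 1) =
      ∑ t ∈ univ.filter (fun t : F => t ≠ 0),
        ∑ x ∈ Fintype.piFinset (fun _ : Fin m => univ.filter (fun x : F => x ≠ 0)),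
          ψ (t * (∑ i, x i + 1)) * ψ (a * (t⁻¹ * (∑ i, (x i)⁻¹ + 1))) := by
  rw [pow_succ', sum_mul]
  refine sum_congr rfl fun t ht => ?_
  replace ht : t ≠ 0 := (mem_filter.mp ht).2
  have hscale : ∑ x ∈ univ.filter (fun x : F => x ≠ 0), ψ (x + a * x⁻¹) =
      ∑ x ∈ univ.filter (fun x : F => x ≠ 0), ψ (t * x + a * (t⁻¹ * x⁻¹)) := by
    refine (sum_equiv (Equiv.mulLeft₀ t ht) ?_ ?_).symm
    · simp [ht]
    · simp [mul_comm]
  rw [hscale, ← Fin.prod_const, prod_univ_sum, mul_sum]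
  refine sum_congr rfl fun x _ => ?_
  rw [show ∏ i, ψ (t * x i + a * (t⁻¹ * (x i)⁻¹)) =
      ψ (∑ i, (t * x i + a * (t⁻¹ * (x i)⁻¹))) from
        (map_sum ψ.toAddMonoidHom _ _).symm, ← AddChar.map_add_eq_mul, ← AddChar.map_add_eq_mul]
  congr 1
  rw [sum_add_distrib, ← mul_sum, ← mul_sum, ← mul_sum]
  ring

/-- Twisted power moments of Kloosterman sums for a nontrivial quadratic character. -/
theorem sum_mulChar_mul_kloosterman_pow [IsDomain R] {χ : MulChar F R} (hχ : χ ≠ 1)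
    (hq : χ.IsQuadratic) {ψ : AddChar F R} (hψ : ψ.IsPrimitive) (m : ℕ) :
    ∑ a, χ a * (∑ x ∈ univ.filter (fun x : F => x ≠ 0), ψ (x + a * x⁻¹)) ^ (m + 1) =
      Fintype.card F * χ (-1) *
        ∑ x ∈ Fintype.piFinset (fun _ : Fin m => univ.filter (fun x : F => x ≠ 0)),
          χ (∑ i, x i + 1) * χ (∑ i, (x i)⁻¹ + 1) := by
  have hinv (t : F) : χ t⁻¹ = χ t := by
    rw [← MulChar.inv_apply', hq.inv]
  have htwist (b : F) : ∑ a, χ a * ψ (a * b) = χ b * gaussSum χ ψ := by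
    rw [sum_mulChar_mul_addChar hχ, hq.inv]
  have hunits (b : F) :
      ∑ t ∈ univ.filter (fun t : F => t ≠ 0), χ t * ψ (t * b) = χ b * gaussSum χ ψ := by
    rw [← htwist b]
    refine sum_subset (subset_univ _) fun t _ ht => ?_
    have : t = 0 := by simpa using ht
    simp [this, MulChar.map_zero]
  calc
    _ = ∑ t ∈ univ.filter (fun t : F => t ≠ 0),
        ∑ x ∈ Fintype.piFinset (fun _ : Fin m => univ.filter (fun x : F => x ≠ 0)),
          ψ (t * (∑ i, x i + 1)) * ∑ a, χ a * ψ (a * (t⁻¹ * (∑ i, (x i)⁻¹ + 1))) := by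
      simp_rw [kloosterman_pow_succ, mul_sum]
      rw [sum_comm]
      refine sum_congr rfl fun t _ => ?_
      rw [sum_comm]
      exact sum_congr rfl fun x _ => sum_congr rfl fun a _ => by ring
    _ = ∑ x ∈ Fintype.piFinset (fun _ : Fin m => univ.filter (fun x : F => x ≠ 0)),
          χ (∑ i, (x i)⁻¹ + 1) * gaussSum χ ψ *
            ∑ t ∈ univ.filter (fun t : F => t ≠ 0), χ t * ψ (t * (∑ i, x i + 1)) := by
      simp_rw [htwist, map_mul, hinv]
      rw [sum_comm]
      simp_rw [mul_sum]
      exact sum_congr rfl fun x _ => sum_congr rfl fun t _ => by ring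
    _ = gaussSum χ ψ ^ 2 *
        ∑ x ∈ Fintype.piFinset (fun _ : Fin m => univ.filter (fun x : F => x ≠ 0)),
          χ (∑ i, x i + 1) * χ (∑ i, (x i)⁻¹ + 1) := by
      simp_rw [hunits, mul_sum]
      exact sum_congr rfl fun x _ => by ring
    _ = _ := by
      rw [gaussSum_sq hχ hq hψ]
      ring

end Moment

theorem theta_eq_stdAddChar (p : ℕ) [NeZero p] (x : ZMod p) : theta p x = ZMod.stdAddChar x := by
  rw [theta, ZMod.stdAddChar_apply, ZMod.toCircle_apply]

theorem phi_eq_quadraticChar (p : ℕ) [Fact p.Prime] (a : ZMod p) :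
    phi p a = quadraticChar (ZMod p) a := by
  simp only [phi, quadraticChar_apply, quadraticCharFun]
  congr

open scoped Classical in
/-- `S(m+1,φ)_p = p φ(−1) Σ_{x₁,…,x_m ∈ F_p^×} φ(x₁+⋯+x_m+1) φ(x₁⁻¹+⋯+x_m⁻¹+1)`. -/
theorem twisted_moment_symmetric_sum (p : ℕ) (hp : p.Prime) (hodd : Odd p)
    (m : ℕ) (hm : 1 ≤ m) :
    haveI : NeZero p := ⟨hp.ne_zero⟩
    S p (m + 1) = (p : ℂ) * (phi p (-1) : ℂ) *
      ∑ x ∈ Finset.univ.filter (fun x : Fin m → ZMod p => ∀ i, x i ≠ 0),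
        (phi p (∑ i, x i + 1) : ℂ) * (phi p (∑ i, (x i)⁻¹ + 1) : ℂ) := by
  have : Fact p.Prime := ⟨hp⟩
  have hchar : ringChar (ZMod p) ≠ 2 := by
    rw [ZMod.ringChar_zmod_n]
    rintro rfl
    exact absurd hodd (by decide)
  have hinj : Function.Injective (Int.castRingHom ℂ) := Int.cast_injective
  have hne : (quadraticChar (ZMod p)).ringHomComp (Int.castRingHom ℂ) ≠ 1 :=
    (MulChar.ringHomComp_ne_one_iff hinj).mpr (quadraticChar_ne_one hchar)
  have h := sum_mulChar_mul_kloosterman_pow hne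
    ((quadraticChar_isQuadratic (ZMod p)).comp (Int.castRingHom ℂ))
    (ZMod.isPrimitive_stdAddChar p) m
  have hset : univ.filter (fun x : Fin m → ZMod p => ∀ i, x i ≠ 0) =
      Fintype.piFinset (fun _ : Fin m => univ.filter (fun x : ZMod p => x ≠ 0)) := by
    ext x
    simp
  rw [hset]
  simpa only [S, Kl, theta_eq_stdAddChar, phi_eq_quadraticChar, MulChar.ringHomComp_apply,
    eq_intCast, ZMod.card] using h
end

section
/- Let p > 3 be an odd prime. Then the number of triples (x,y,z) ∈ (F_p^×)³ satisfying simultaneously 1 + x + y + z = 0 and 1 + x⁻¹ + y⁻¹ + z⁻¹ = 0 equals 3(p−2). -/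
open Finset

/-- If `1, x, y, z` and their inverses both sum to zero, then one of `x, y, z` is `-1`. -/
theorem one_add_mul_one_add_mul_one_add_eq_zero {F : Type*} [Field F] {x y z : F}
    (hx : x ≠ 0) (hy : y ≠ 0) (hz : z ≠ 0) (h : 1 + x + y + z = 0)
    (hinv : 1 + x⁻¹ + y⁻¹ + z⁻¹ = 0) : (1 + x) * (1 + y) * (1 + z) = 0 := by
  have key : x * y * z + y * z + x * z + x * y = 0 := by
    calc x * y * z + y * z + x * z + x * y
        = x * y * z * (1 + x⁻¹ + y⁻¹ + z⁻¹) := by field_simp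
      _ = 0 := by rw [hinv, mul_zero]
  linear_combination h + key

/-- The solutions are the cyclic rotations of `(-1, a, -a)`; excluding `a = -1` makes the
three families disjoint. -/
theorem simultaneous_solution_iff {F : Type*} [Field F] (h2 : (2 : F) ≠ 0) (x y z : F) :
    (x ≠ 0 ∧ y ≠ 0 ∧ z ≠ 0 ∧ 1 + x + y + z = 0 ∧ 1 + x⁻¹ + y⁻¹ + z⁻¹ = 0) ↔
      (∃ a, (a ≠ 0 ∧ a ≠ -1) ∧ (-1, a, -a) = (x, y, z)) ∨
      (∃ a, (a ≠ 0 ∧ a ≠ -1) ∧ (-a, -1, a) = (x, y, z)) ∨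
      (∃ a, (a ≠ 0 ∧ a ≠ -1) ∧ (a, -a, -1) = (x, y, z)) := by
  have h1 : (1 : F) ≠ -1 := fun h => h2 (by linear_combination h)
  constructor
  · rintro ⟨hx, hy, hz, h, hinv⟩
    have hprod := one_add_mul_one_add_mul_one_add_eq_zero hx hy hz h hinv
    simp only [mul_eq_zero] at hprod
    simp only [Prod.mk.injEq]
    by_cases hx1 : x = -1
    · by_cases hy1 : y = -1
      · have hz1 : z = 1 := by linear_combination h - hx1 - hy1
        refine Or.inr (Or.inl ⟨1, ⟨one_ne_zero, h1⟩, hx1.symm, hy1.symm, hz1.symm⟩)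
      · exact Or.inl ⟨y, ⟨hy, hy1⟩, hx1.symm, rfl, by linear_combination hx1 - h⟩
    · by_cases hy1 : y = -1
      · by_cases hz1 : z = -1
        · have hx' : x = 1 := by linear_combination h - hy1 - hz1
          exact Or.inr (Or.inr ⟨1, ⟨one_ne_zero, h1⟩, hx'.symm, hy1.symm, hz1.symm⟩)
        · exact Or.inr (Or.inl ⟨z, ⟨hz, hz1⟩, by linear_combination hy1 - h, hy1.symm, rfl⟩)
      · have hz1 : z = -1 := by
          rcases hprod with (h' | h') | h'
          · exact absurd (by linear_combination h') hx1
          · exact absurd (by linear_combination h') hy1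
          · linear_combination h'
        exact Or.inr (Or.inr ⟨x, ⟨hx, hx1⟩, rfl, by linear_combination hz1 - h, hz1.symm⟩)
  · simp only [Prod.mk.injEq]
    rintro (⟨a, ⟨ha, -⟩, rfl, rfl, rfl⟩ | ⟨a, ⟨ha, -⟩, rfl, rfl, rfl⟩ |
      ⟨a, ⟨ha, -⟩, rfl, rfl, rfl⟩) <;> simp [ha, inv_neg]

/-- The number of triples `(x,y,z) ∈ (F_p^×)³` with `1+x+y+z = 0` and `1+x⁻¹+y⁻¹+z⁻¹ = 0`
equals `3(p−2)`. -/
theorem count_simultaneous_solutions (p : ℕ) (hp : p.Prime) (h3 : 3 < p) :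
    haveI : NeZero p := ⟨hp.ne_zero⟩
    (Finset.univ.filter (fun t : ZMod p × ZMod p × ZMod p =>
        t.1 ≠ 0 ∧ t.2.1 ≠ 0 ∧ t.2.2 ≠ 0 ∧
        1 + t.1 + t.2.1 + t.2.2 = 0 ∧
        1 + t.1⁻¹ + t.2.1⁻¹ + t.2.2⁻¹ = 0)).card = 3 * (p - 2) := by
  have : Fact p.Prime := ⟨hp⟩
  have h2 : (2 : ZMod p) ≠ 0 := by
    have : ((2 : ℕ) : ZMod p) ≠ 0 := by
      rw [Ne, ZMod.natCast_eq_zero_iff]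
      exact Nat.not_dvd_of_pos_of_lt two_pos (by omega)
    exact_mod_cast this
  let S : Finset (ZMod p) := {0, -1}ᶜ
  have hS : S.card = p - 2 := by
    rw [Finset.card_compl, ZMod.card, Finset.card_pair (by simp)]
  have memS (a : ZMod p) : a ∈ S ↔ a ≠ 0 ∧ a ≠ -1 := by simp [S]
  let A := S.image fun a => ((-1, a, -a) : ZMod p × ZMod p × ZMod p)
  let B := S.image fun a => ((-a, -1, a) : ZMod p × ZMod p × ZMod p)
  let C := S.image fun a => ((a, -a, -1) : ZMod p × ZMod p × ZMod p)
  have hA : A.card = p - 2 := by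
    rw [Finset.card_image_of_injective _ fun a b h => by simpa using h, hS]
  have hB : B.card = p - 2 := by
    rw [Finset.card_image_of_injective _ fun a b h => by simpa using h, hS]
  have hC : C.card = p - 2 := by
    rw [Finset.card_image_of_injective _ fun a b h => by simpa using h, hS]
  have hBC : Disjoint B C := by
    simp only [B, C, Finset.disjoint_left, Finset.mem_image, memS]
    rintro _ ⟨a, ha, rfl⟩ ⟨b, hb, h⟩
    simp only [Prod.mk.injEq] at h
    exact ha.2 h.2.2.symm
  have hABC : Disjoint A (B ∪ C) := by
    simp only [A, B, C, Finset.disjoint_left, Finset.mem_union, Finset.mem_image, memS]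
    rintro _ ⟨a, ha, rfl⟩ (⟨b, hb, h⟩ | ⟨b, hb, h⟩) <;> simp only [Prod.mk.injEq] at h
    · exact ha.2 h.2.1.symm
    · exact hb.2 h.1
  have hcard : (A ∪ (B ∪ C)).card = 3 * (p - 2) := by
    rw [Finset.card_union_of_disjoint hABC, Finset.card_union_of_disjoint hBC, hA, hB, hC]
    ring
  rw [← hcard]
  congr 1
  ext ⟨x, y, z⟩
  simp only [A, B, C, Finset.mem_filter, Finset.mem_univ, true_and, Finset.mem_union,
    Finset.mem_image, memS]
  exact simultaneous_solution_iff h2 x y z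
end

section
/- Let p > 3 be an odd prime. Then Σ_{γ ∈ F_p} Σ_{μ ∈ F_p} φ(μ)·φ(μ − 4γ − 4)·φ(μ + γ²) = 1. -/
open Finset

section QuadraticChar

variable {F : Type*} [Field F] [Fintype F] [DecidableEq F]

theorem sum_quadraticChar_add (hF : ringChar F ≠ 2) (a : F) :
    ∑ x : F, quadraticChar F (x + a) = 0 := by
  rw [← quadraticChar_sum_zero hF]
  exact Fintype.sum_equiv (Equiv.addRight a) _ _ fun _ => rfl

theorem quadraticChar_mul_self {a : F} (ha : a ≠ 0) :
    quadraticChar F a * quadraticChar F a = 1 := by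
  rw [← sq]
  exact quadraticChar_sq_one ha

theorem sum_quadraticChar_mul_self :
    ∑ x : F, quadraticChar F x * quadraticChar F x = Fintype.card F - 1 := by
  have h (x : F) : quadraticChar F x * quadraticChar F x = 1 - if x = 0 then 1 else 0 := by
    by_cases hx : x = 0
    · simp [hx]
    · simp [hx, quadraticChar_mul_self hx, -quadraticChar_apply]
  simp [h, -quadraticChar_apply]

/-- The character sum of a product of two monic linear factors. -/
theorem sum_quadraticChar_sub_mul_sub (hF : ringChar F ≠ 2) (a b : F) :
    ∑ x : F, quadraticChar F (x - a) * quadraticChar F (x - b) =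
      -1 + if a = b then (Fintype.card F : ℤ) else 0 := by
  by_cases hab : a = b
  · subst hab
    rw [if_pos rfl, ← Fintype.sum_equiv (Equiv.addRight a) _ _ (fun _ => rfl)]
    simp [sum_quadraticChar_mul_self, -quadraticChar_apply]
    ring
  · have hba : b - a ≠ 0 := sub_ne_zero.2 (Ne.symm hab)
    have hJ := jacobiSum_nontrivial_inv (quadraticChar_ne_one hF)
    rw [(quadraticChar_isQuadratic F).inv, jacobiSum] at hJ
    rw [if_neg hab, ← Fintype.sum_equiv ((Equiv.mulLeft₀ _ hba).trans (Equiv.addRight a))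
      _ _ (fun _ => rfl)]
    have h (y : F) : quadraticChar F ((b - a) * y + a - a) * quadraticChar F ((b - a) * y + a - b)
        = quadraticChar F (-1) * (quadraticChar F y * quadraticChar F (1 - y)) := by
      have e : (b - a) * y + a - b = (b - a) * (-1 * (1 - y)) := by ring
      rw [e, add_sub_cancel_right]
      simp only [map_mul]
      linear_combination (quadraticChar F y * quadraticChar F (-1) * quadraticChar F (1 - y)) *
        quadraticChar_mul_self hba
    simp only [Equiv.trans_apply, Equiv.mulLeft₀_apply, Equiv.coe_addRight, h, ← mul_sum, hJ]
    linear_combination -quadraticChar_mul_self (neg_ne_zero.2 (one_ne_zero (α := F)))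

theorem quadraticChar_neg_four (hF : ringChar F ≠ 2) :
    quadraticChar F (-4) = quadraticChar F (-1) := by
  have h2 : (2 : F) ≠ 0 := Ring.two_ne_zero hF
  have e : (-4 : F) = -1 * (2 * 2) := by norm_num
  rw [e, map_mul, map_mul, quadraticChar_mul_self h2, mul_one]

/-- The fibre over `γ`, after the substitution `μ = t * γ`. -/
theorem sum_fibre_substitution (hF : ringChar F ≠ 2) (γ : F) :
    ∑ μ : F, quadraticChar F μ * quadraticChar F (μ - 4 * γ - 4) * quadraticChar F (μ + γ ^ 2) =
      (∑ t : F, quadraticChar F t * quadraticChar F ((t - 4) * γ - 4) * quadraticChar F (γ + t)) -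
        if γ = 0 then Fintype.card F * quadraticChar F (-1) else 0 := by
  by_cases hγ : γ = 0
  · subst hγ
    have h (x : F) : quadraticChar F x * quadraticChar F (x - 4) * quadraticChar F x =
        quadraticChar F (x + -4) - if x = 0 then quadraticChar F (-4) else 0 := by
      by_cases hx : x = 0
      · simp [hx]
      · rw [if_neg hx, sub_zero, ← sub_eq_add_neg]
        linear_combination quadraticChar F (x - 4) * quadraticChar_mul_self hx
    have h' (x : F) : quadraticChar F x * quadraticChar F (-4) * quadraticChar F x =
        quadraticChar F (-1) * (quadraticChar F x * quadraticChar F x) := by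
      rw [quadraticChar_neg_four hF]
      ring
    simp only [mul_zero, sub_zero, zero_sub, zero_add, ne_eq, OfNat.ofNat_ne_zero,
      not_false_eq_true, zero_pow, add_zero, h, h', sum_sub_distrib, sum_quadraticChar_add hF,
      ← mul_sum, sum_quadraticChar_mul_self, if_true, sum_ite_eq', mem_univ]
    rw [quadraticChar_neg_four hF]
    ring
  · rw [if_neg hγ, sub_zero]
    refine (Fintype.sum_equiv (Equiv.mulRight₀ γ hγ) _ _ fun t => ?_).symm
    have e1 : t * γ - 4 * γ - 4 = (t - 4) * γ - 4 := by ring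
    have e2 : t * γ + γ ^ 2 = γ * (γ + t) := by ring
    simp only [Equiv.mulRight₀_apply, e1, e2]
    simp only [map_mul]
    linear_combination (-quadraticChar F t * quadraticChar F ((t - 4) * γ - 4) *
      quadraticChar F (γ + t)) * quadraticChar_mul_self hγ

theorem sum_fibre_slope (hF : ringChar F ≠ 2) (t : F) :
    ∑ γ : F, quadraticChar F t * quadraticChar F ((t - 4) * γ - 4) * quadraticChar F (γ + t) =
      -(quadraticChar F (t - 0) * quadraticChar F (t - 4)) +
        if t = 2 then Fintype.card F * quadraticChar F (-1) else 0 := by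
  have h2 : (2 : F) ≠ 0 := Ring.two_ne_zero hF
  by_cases h4 : t = 4
  · subst h4
    have h42 : (4 : F) ≠ 2 := fun h => h2 (by linear_combination h)
    simp [h42, ← mul_sum, sum_quadraticChar_add hF, quadraticChar_eq_zero_iff,
      -quadraticChar_apply]
  · have h4' : t - 4 ≠ 0 := sub_ne_zero.2 h4
    have h (γ : F) : quadraticChar F t * quadraticChar F ((t - 4) * γ - 4) *
        quadraticChar F (γ + t) = quadraticChar F t * quadraticChar F (t - 4) *
          (quadraticChar F (γ - 4 / (t - 4)) * quadraticChar F (γ - -t)) := by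
      have e : (t - 4) * γ - 4 = (t - 4) * (γ - 4 / (t - 4)) := by field_simp
      rw [e, map_mul, sub_neg_eq_add]
      ring
    have hiff : 4 / (t - 4) = -t ↔ t = 2 := by
      rw [div_eq_iff h4']
      constructor
      · intro h
        have : (t - 2) ^ 2 = 0 := by linear_combination h
        exact sub_eq_zero.1 (pow_eq_zero_iff two_ne_zero |>.1 this)
      · rintro rfl
        norm_num
    simp only [h, ← mul_sum, sum_quadraticChar_sub_mul_sub hF, hiff, sub_zero]
    split_ifs with ht
    · subst ht
      have e : quadraticChar F 2 * quadraticChar F (2 - 4) = quadraticChar F (-1) := by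
        rw [← map_mul, ← quadraticChar_neg_four hF]
        norm_num
      rw [e]
      ring
    · ring

theorem sum_quadraticChar_triple (hF : ringChar F ≠ 2) :
    ∑ γ : F, ∑ μ : F, quadraticChar F μ * quadraticChar F (μ - 4 * γ - 4) *
      quadraticChar F (μ + γ ^ 2) = 1 := by
  have h2 : (2 : F) ≠ 0 := Ring.two_ne_zero hF
  have h4 : (0 : F) ≠ 4 := fun h => mul_ne_zero h2 h2 (by linear_combination -h)
  simp only [sum_fibre_substitution hF, sum_sub_distrib]
  rw [sum_comm]
  simp only [sum_fibre_slope hF, sum_add_distrib, sum_neg_distrib,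
    sum_quadraticChar_sub_mul_sub hF, if_neg h4, sum_ite_eq', mem_univ, if_true]
  ring

end QuadraticChar

/-- `Σ_{γ,μ ∈ F_p} φ(μ) φ(μ − 4γ − 4) φ(μ + γ²) = 1`. -/
theorem triple_character_sum (p : ℕ) (hp : p.Prime) (h3 : 3 < p) :
    haveI : NeZero p := ⟨hp.ne_zero⟩
    (∑ γ : ZMod p, ∑ μ : ZMod p,
      phi p μ * phi p (μ - 4 * γ - 4) * phi p (μ + γ ^ 2)) = 1 := by
  have : Fact p.Prime := ⟨hp⟩
  have hF : ringChar (ZMod p) ≠ 2 := by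
    rw [ZMod.ringChar_zmod_n]
    omega
  simp only [phi_eq_quadraticChar]
  exact sum_quadraticChar_triple hF
end

section
/- Let p ≥ 5 be a prime with p ≡ 3 (mod 4), and let λ ∈ F_p \ {0,1,−1} be such that j(E_{λ²}^Leg) = 1728. Then the trace of Frobenius of E_{λ²}^Leg vanishes: a_p(λ²) = −Σ_{x ∈ F_p} φ(x(x−1)(x−λ²)) = 0. -/
open Finset

/-- The trace of Frobenius of the Legendre elliptic curve `y² = x(x−1)(x−λ)`:
`a_p(λ) = −Σ_{x ∈ F_p} φ(x(x−1)(x−λ))`. -/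
noncomputable def ap (p : ℕ) [NeZero p] (l : ZMod p) : ℤ :=
  -∑ x : ZMod p, phi p (x * (x - 1) * (x - l))

/-- The j-invariant of the Legendre curve `E_λ^Leg`:
`j = 2⁸ (λ²−λ+1)³ / (λ²(λ−1)²)`. -/
def jLeg (p : ℕ) (l : ZMod p) : ZMod p :=
  2 ^ 8 * (l ^ 2 - l + 1) ^ 3 * (l ^ 2 * (l - 1) ^ 2)⁻¹

theorem quadraticChar_neg_of_mod_four_eq_three (p : ℕ) [Fact p.Prime] (h4 : p % 4 = 3)
    (a : ZMod p) : quadraticChar (ZMod p) (-a) = -quadraticChar (ZMod p) a := by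
  have hchar : quadraticChar (ZMod p) (-1) = -1 := by
    rw [quadraticChar_neg_one_iff_not_isSquare]
    exact fun h => ZMod.exists_sq_eq_neg_one_iff.mp h h4
  rw [neg_eq_neg_one_mul, map_mul, hchar, neg_one_mul]

/-- The trace vanishes as soon as the cubic is odd under a reflection `x ↦ c - x`. -/
theorem ap_eq_zero_of_reflection (p : ℕ) [Fact p.Prime] (h4 : p % 4 = 3) (m c : ZMod p)
    (hc : ∀ x : ZMod p, (c - x) * (c - x - 1) * (c - x - m) = -(x * (x - 1) * (x - m))) :
    ap p m = 0 := by
  have hsum : ∑ x : ZMod p, phi p (x * (x - 1) * (x - m)) =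
      -∑ x : ZMod p, phi p (x * (x - 1) * (x - m)) := by
    rw [← Finset.sum_neg_distrib, ← Equiv.sum_comp (Equiv.subLeft c)]
    refine Finset.sum_congr rfl fun x _ => ?_
    rw [Equiv.subLeft_apply, hc, phi_eq_quadraticChar, phi_eq_quadraticChar,
      quadraticChar_neg_of_mod_four_eq_three p h4]
  unfold ap
  linarith

/-- The Legendre parameters with j-invariant `1728` are `-1`, `2` and `1/2`. -/
theorem eq_of_jLeg_eq_1728 (p : ℕ) [Fact p.Prime] (h2 : (2 : ZMod p) ≠ 0) (m : ZMod p)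
    (hm0 : m ≠ 0) (hm1 : m ≠ 1) (hj : jLeg p m = 1728) : m = -1 ∨ m = 2 ∨ 2 * m = 1 := by
  have hden : m ^ 2 * (m - 1) ^ 2 ≠ 0 :=
    mul_ne_zero (pow_ne_zero 2 hm0) (pow_ne_zero 2 (sub_ne_zero.mpr hm1))
  unfold jLeg at hj
  rw [← div_eq_mul_inv, div_eq_iff hden] at hj
  have hsq : 2 ^ 6 * ((m + 1) * (m - 2) * (2 * m - 1)) ^ 2 = 0 := by linear_combination hj
  have hprod := pow_eq_zero_iff two_ne_zero |>.mp
    ((mul_eq_zero.mp hsq).resolve_left (pow_ne_zero 6 h2))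
  rcases mul_eq_zero.mp hprod with h | h
  · rcases mul_eq_zero.mp h with h | h
    · exact Or.inl (eq_neg_of_add_eq_zero_left h)
    · exact Or.inr (Or.inl (sub_eq_zero.mp h))
  · exact Or.inr (Or.inr (sub_eq_zero.mp h))

/-- If `p ≡ 3 (mod 4)` and `j(E_{λ²}^Leg) = 1728`, then `a_p(λ²) = 0`. -/
theorem trace_vanishes_j_1728 (p : ℕ) (hp : p.Prime) (h5 : 5 ≤ p) (h4 : p % 4 = 3)
    (l : ZMod p) (hl0 : l ≠ 0) (hl1 : l ≠ 1) (hlm : l ≠ -1)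
    (hj : jLeg p (l ^ 2) = 1728) :
    haveI : NeZero p := ⟨hp.ne_zero⟩
    ap p (l ^ 2) = 0 := by
  have : Fact p.Prime := ⟨hp⟩
  have h2 : (2 : ZMod p) ≠ 0 :=
    Ring.two_ne_zero (by rw [ZMod.ringChar_zmod_n]; omega)
  have hsq1 : l ^ 2 ≠ 1 :=
    fun h => (eq_or_eq_neg_of_sq_eq_sq l 1 (h.trans (one_pow 2).symm)).elim hl1 hlm
  have hm := eq_of_jLeg_eq_1728 p h2 (l ^ 2) (pow_ne_zero 2 hl0) hsq1 hj
  generalize l ^ 2 = m at hm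
  rcases hm with rfl | rfl | h
  · exact ap_eq_zero_of_reflection p h4 _ 0 fun x => by ring
  · exact ap_eq_zero_of_reflection p h4 _ 2 fun x => by ring
  · exact ap_eq_zero_of_reflection p h4 _ 1 fun x => by linear_combination (x - x ^ 2) * h
end
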